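/- The full lift Λ is invariant under changes of reference frame: for every H = [[R_H, 0, p_H],[0₂ₓ₃, I₂]] ∈ SE₂(3) with R_H ∈ SO(3), R_H e₃ = e₃, p_H ∈ ℝ³, every state ξ = (P, b, S, K) ∈ M and every input u = (ω, a, b_ω, b_a, τ, μ, ζ), one has Λ(α(H, ξ), u) = Λ(ξ, u), where α(H, (P, b, S, K)) = (H⁻¹P, b, S, K) and Λ = (Λ₁, Λ₂, Λ₃, Λ₄) with Λ₁ = (W − B + D) + P⁻¹(G − D)P, Λ₂ = bΠ(Λ₁) − Π(Λ₁)b − τ, Λ₃ = S⁻¹Υ(Λ₁)S + μ, Λ₄ = ζ. -/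

import Mathlib

open Matrix

noncomputable section

abbrev M3 := Matrix (Fin 3) (Fin 3) ℝ
abbrev M4 := Matrix (Fin 4) (Fin 4) ℝ
abbrev M5 := Matrix (Fin 5) (Fin 5) ℝ

/-- The special orthogonal group SO(3) as a set of 3×3 real matrices. -/
def SO3 : Set M3 := {A | A * Aᵀ = 1 ∧ A.det = 1}

/-- Block matrix [[A, a],[0₁ₓ₃, 1]]. -/
def SE3mk (A : M3) (a : Fin 3 → ℝ) : M4 :=
  Matrix.of fun i j =>
    if hi : (i : ℕ) < 3 then
      if hj : (j : ℕ) < 3 then A ⟨i, hi⟩ ⟨j, hj⟩ else a ⟨i, hi⟩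
    else
      if (j : ℕ) < 3 then 0 else 1

/-- SE(3) as a set of 4×4 real matrices. -/
def SE3set : Set M4 := {X | ∃ A a, A ∈ SO3 ∧ X = SE3mk A a}

/-- Block matrix [[A, a, b],[0₂ₓ₃, I₂]]. -/
def SE23mk (A : M3) (a b : Fin 3 → ℝ) : M5 :=
  Matrix.of fun i j =>
    if hi : (i : ℕ) < 3 then
      if hj : (j : ℕ) < 3 then A ⟨i, hi⟩ ⟨j, hj⟩
      else if (j : ℕ) = 3 then a ⟨i, hi⟩ else b ⟨i, hi⟩
    else
      if i = j then 1 else 0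

/-- SE₂(3) as a set of 5×5 real matrices. -/
def SE23set : Set M5 := {P | ∃ A a b, A ∈ SO3 ∧ P = SE23mk A a b}

/-- Block matrix [[Ω, v],[0₁ₓ₃, 0]]. -/
def se3mk (Ω : M3) (v : Fin 3 → ℝ) : M4 :=
  Matrix.of fun i j =>
    if hi : (i : ℕ) < 3 then
      if hj : (j : ℕ) < 3 then Ω ⟨i, hi⟩ ⟨j, hj⟩ else v ⟨i, hi⟩
    else 0

/-- The Lie algebra se(3) as a set of 4×4 real matrices. -/
def se3set : Set M4 := {u | ∃ Ω v, Ωᵀ = -Ω ∧ u = se3mk Ω v}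

/-- Block matrix [[Ω, v, w],[0₂ₓ₃, 0₂ₓ₂]]. -/
def se23mkAlg (Ω : M3) (v w : Fin 3 → ℝ) : M5 :=
  Matrix.of fun i j =>
    if hi : (i : ℕ) < 3 then
      if hj : (j : ℕ) < 3 then Ω ⟨i, hi⟩ ⟨j, hj⟩
      else if (j : ℕ) = 3 then v ⟨i, hi⟩ else w ⟨i, hi⟩
    else 0

/-- The Lie algebra se₂(3) as a set of 5×5 real matrices. -/
def se23set : Set M5 := {u | ∃ Ω v w, Ωᵀ = -Ω ∧ u = se23mkAlg Ω v w}

/-- Camera intrinsics matrix [[a, 0, x],[0, b, y],[0, 0, 1]]. -/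
def INmk (a b x y : ℝ) : M3 := !![a, 0, x; 0, b, y; 0, 0, 1]

/-- The intrinsics group IN as a set of 3×3 real matrices. -/
def INset : Set M3 := {K | ∃ a b x y : ℝ, 0 < a ∧ 0 < b ∧ K = INmk a b x y}

/-- χ : SE₂(3) → SE(3), [[A, a, b],[0₂ₓ₃, I₂]] ↦ [[A, a],[0₁ₓ₃, 1]]. -/
def chi (D : M5) : M4 :=
  Matrix.of fun i j =>
    if (i : ℕ) < 3 then
      if (j : ℕ) < 3 then D (Fin.castSucc i) (Fin.castSucc j) else D (Fin.castSucc i) 3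
    else
      if (j : ℕ) < 3 then 0 else 1

/-- Θ : SE₂(3) → SE(3), [[A, a, b],[0₂ₓ₃, I₂]] ↦ [[A, b],[0₁ₓ₃, 1]]. -/
def Theta (D : M5) : M4 :=
  Matrix.of fun i j =>
    if (i : ℕ) < 3 then
      if (j : ℕ) < 3 then D (Fin.castSucc i) (Fin.castSucc j) else D (Fin.castSucc i) 4
    else
      if (j : ℕ) < 3 then 0 else 1

/-- The skew-symmetric matrix ω^∧ with ω^∧ x = ω × x. -/
def wedge (ω : Fin 3 → ℝ) : M3 :=
  !![0, -ω 2, ω 1; ω 2, 0, -ω 0; -ω 1, ω 0, 0]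

/-- The input matrix W = [[ω^∧, a, 0],[0₂ₓ₃, 0₂ₓ₂]]. -/
def Wmat (ω a : Fin 3 → ℝ) : M5 := se23mkAlg (wedge ω) a 0

/-- The drift matrix D: only nonzero entry is a 1 in position (4,5) (1-indexed). -/
def Dmat : M5 := Matrix.of fun i j => if (i : ℕ) = 3 ∧ (j : ℕ) = 4 then 1 else 0

/-- The gravity matrix G: only nonzero entries are g·e₃ in rows 1–3 of column 4 (1-indexed). -/
def Gmat (g : ℝ) : M5 := Matrix.of fun i j => if (i : ℕ) = 2 ∧ (j : ℕ) = 3 then g else 0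

/-- The direction of gravity e₃ = (0,0,1). -/
def e3 : Fin 3 → ℝ := ![0, 0, 1]

/-- Elements of the symmetry group G = (SE₂(3) ⋉ se(3)) × SE(3) × IN. -/
abbrev GT := (M5 × M4) × M4 × M3

/-- Elements of the state space M = SE₂(3) × se(3) × SE(3) × IN. -/
abbrev MT := M5 × M4 × M4 × M3

/-- The symmetry group G as a subset of GT. -/
def Gset : Set GT := {X | X.1.1 ∈ SE23set ∧ X.1.2 ∈ se3set ∧ X.2.1 ∈ SE3set ∧ X.2.2 ∈ INset}

/-- The state space M as a subset of MT. -/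
def Mset : Set MT := {ξ | ξ.1 ∈ SE23set ∧ ξ.2.1 ∈ se3set ∧ ξ.2.2.1 ∈ SE3set ∧ ξ.2.2.2 ∈ INset}

/-- Group product on G. -/
def gMul (X Y : GT) : GT :=
  ((X.1.1 * Y.1.1, X.1.2 + chi X.1.1 * Y.1.2 * (chi X.1.1)⁻¹), X.2.1 * Y.2.1, X.2.2 * Y.2.2)

/-- Identity element of G. -/
def gOne : GT := ((1, 0), 1, 1)

/-- The group action φ of G on M. -/
def phi (X : GT) (ξ : MT) : MT :=
  (ξ.1 * X.1.1, (chi X.1.1)⁻¹ * (ξ.2.1 - X.1.2) * chi X.1.1,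
   (Theta X.1.1)⁻¹ * ξ.2.2.1 * X.2.1, ξ.2.2.2 * X.2.2)

/-- The reference-frame change action α(H, (P, b, S, K)) = (H⁻¹P, b, S, K). -/
def alphaAct (H : M5) (ξ : MT) : MT := (H⁻¹ * ξ.1, ξ.2)

/-- Π : se₂(3) → se(3), [[Ω, v, w],[0, 0]] ↦ [[Ω, v],[0, 0]]. -/
def Pi5 (u : M5) : M4 :=
  Matrix.of fun i j =>
    if (i : ℕ) < 3 then
      if (j : ℕ) < 3 then u (Fin.castSucc i) (Fin.castSucc j) else u (Fin.castSucc i) 3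
    else 0

/-- Υ : se₂(3) → se(3), [[Ω, v, w],[0, 0]] ↦ [[Ω, w],[0, 0]]. -/
def Ups5 (u : M5) : M4 :=
  Matrix.of fun i j =>
    if (i : ℕ) < 3 then
      if (j : ℕ) < 3 then u (Fin.castSucc i) (Fin.castSucc j) else u (Fin.castSucc i) 4
    else 0

/-- The full lift Λ = (Λ₁, Λ₂, Λ₃, Λ₄) of the visual-inertial navigation system. -/
def Lambda (g : ℝ) (ξ : MT) (ω a bω ba : Fin 3 → ℝ) (τ μ : M4) (ζ : M3) :
    M5 × M4 × M4 × M3 :=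
  let L1 : M5 := (Wmat ω a - Wmat bω ba + Dmat) + ξ.1⁻¹ * (Gmat g - Dmat) * ξ.1
  (L1,
   ξ.2.1 * Pi5 L1 - Pi5 L1 * ξ.2.1 - τ,
   ξ.2.2.1⁻¹ * Ups5 L1 * ξ.2.2.1 + μ,
   ζ)

theorem SE23mk_isUnit_det (R : M3) (p : Fin 3 → ℝ) (hR : R ∈ SO3) :
    IsUnit (SE23mk R 0 p).det := by
  have h1 : R * Rᵀ = 1 := hR.1
  have hp : R *ᵥ (Rᵀ *ᵥ p) = p := by rw [Matrix.mulVec_mulVec, h1, Matrix.one_mulVec]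
  have key : SE23mk R 0 p * SE23mk Rᵀ 0 (-(Rᵀ *ᵥ p)) = 1 := by
    generalize Rᵀ *ᵥ p = q at hp ⊢
    generalize Rᵀ = T at h1 ⊢
    ext i j
    have e (i j : Fin 3) := congrFun (congrFun h1 i) j
    have f (i : Fin 3) := congrFun hp i
    simp only [Matrix.mul_apply, Fin.sum_univ_three] at e
    simp only [Matrix.mulVec, dotProduct, Fin.sum_univ_three] at f
    have e00 := e 0 0
    have e01 := e 0 1
    have e02 := e 0 2
    have e10 := e 1 0
    have e11 := e 1 1
    have e12 := e 1 2
    have e20 := e 2 0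
    have e21 := e 2 1
    have e22 := e 2 2
    have f0 := f 0
    have f1 := f 1
    have f2 := f 2
    clear e f
    fin_cases i <;> fin_cases j <;>
      simp [Matrix.mul_apply, Fin.sum_univ_five, SE23mk, Matrix.one_apply] at * <;> linarith
  exact (Matrix.isUnit_iff_isUnit_det _).1 (IsUnit.of_mul_eq_one _ key)

theorem SE23mk_comm (g : ℝ) (R : M3) (p : Fin 3 → ℝ) (he : R *ᵥ e3 = e3) :
    SE23mk R 0 p * (Gmat g - Dmat) = (Gmat g - Dmat) * SE23mk R 0 p := by
  have f0 := congrFun he 0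
  have f1 := congrFun he 1
  have f2 := congrFun he 2
  simp [Matrix.mulVec, dotProduct, Fin.sum_univ_three, e3] at f0 f1 f2
  ext i j
  fin_cases i <;> fin_cases j <;>
    simp [Matrix.mul_apply, Fin.sum_univ_five, SE23mk, Gmat, Dmat, f0, f1, f2]

/-- the full lift Λ is invariant under changes of reference frame:
Λ(α(H, ξ), u) = Λ(ξ, u). -/
theorem stmt16 (g : ℝ) (R : M3) (p : Fin 3 → ℝ) (hR : R ∈ SO3) (he : R *ᵥ e3 = e3)
    (ξ : MT) (hξ : ξ ∈ Mset) (ω a bω ba : Fin 3 → ℝ)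
    (τ μ : M4) (hτ : τ ∈ se3set) (hμ : μ ∈ se3set)
    (ζ : M3) (hζ : ∃ α β x y : ℝ, ζ = !![α, 0, x; 0, β, y; 0, 0, 0]) :
    Lambda g (alphaAct (SE23mk R 0 p) ξ) ω a bω ba τ μ ζ = Lambda g ξ ω a bω ba τ μ ζ := by
  have hu := SE23mk_isUnit_det R p hR
  have key : (alphaAct (SE23mk R 0 p) ξ).1⁻¹ * (Gmat g - Dmat) * (alphaAct (SE23mk R 0 p) ξ).1
      = ξ.1⁻¹ * (Gmat g - Dmat) * ξ.1 := by
    simp only [alphaAct]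
    rw [Matrix.mul_inv_rev, Matrix.nonsing_inv_nonsing_inv _ hu, Matrix.mul_assoc ξ.1⁻¹,
      SE23mk_comm g R p he]
    simp only [Matrix.mul_assoc]
    rw [Matrix.mul_nonsing_inv_cancel_left _ _ hu]
  simp only [Lambda, key]
  rfl
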